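/- For every 0 < α < n/2, the low-SNR asymptotic capacity satisfies lim_{A↓0} C_{h,σ²}(A, αA) / (A²/σ²) = γ/2, where γ = max over vectors (q_1,…,q_n) with q_k ≥ 0 for all k, ∑_{k=1}^n q_k ≤ 1 and ∑_{k=1}^n k·q_k ≤ α, of ( ∑_{k=1}^n s_k² q_k − ( ∑_{k=1}^n s_k q_k )² ). -/

import Mathlib

open MeasureTheory ProbabilityTheory Real Filter
open scoped NNReal ENNReal Classical

noncomputable section

/-- Kullback–Leibler divergence (Mathlib's `ProbabilityTheory.klDiv`). -/
def klDiv {α : Type*} [MeasurableSpace α] (μ ν : Measure α) : EReal :=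
  if μ ≪ ν ∧ Integrable (llr μ ν) μ then ((∫ x, llr μ ν x ∂μ : ℝ) : EReal) else ⊤

/-- Mutual information of a joint law: KL divergence of the joint law from the
product of its marginals. -/
def mutualInfo {α β : Type*} [MeasurableSpace α] [MeasurableSpace β]
    (joint : Measure (α × β)) : EReal :=
  klDiv joint ((joint.map Prod.fst).prod (joint.map Prod.snd))

/-- Partial sums `s_k = h_1 + ⋯ + h_k`. -/
def sCum {n : ℕ} (h : Fin n → ℝ) (k : ℕ) : ℝ :=
  ∑ i : Fin n, if i.val < k then h i else 0

/-- Joint law of `(X, Y)` with `Y = hᵀX + Z`, `Z ~ N(0, v)` independent of `X`. -/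
def misoJoint {n : ℕ} (h : Fin n → ℝ) (v : ℝ≥0) (μ : Measure (Fin n → ℝ)) :
    Measure ((Fin n → ℝ) × ℝ) :=
  (μ.prod (gaussianReal 0 v)).map (fun p => (p.1, (∑ k, h k * p.1 k) + p.2))

/-- MISO capacity under peak-power constraint `A` and average-power constraint `E`. -/
def misoCapacity {n : ℕ} (h : Fin n → ℝ) (v : ℝ≥0) (A E : ℝ) : EReal :=
  ⨆ μ ∈ {μ : Measure (Fin n → ℝ) | IsProbabilityMeasure μ ∧
      (∀ k, ∀ᵐ x ∂μ, x k ∈ Set.Icc 0 A) ∧ (∑ k, ∫ x, x k ∂μ) ≤ E},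
    mutualInfo (misoJoint h v μ)

/-- MISO capacity under only an average-power constraint `E`. -/
def misoCapacityAvg {n : ℕ} (h : Fin n → ℝ) (v : ℝ≥0) (E : ℝ) : EReal :=
  ⨆ μ ∈ {μ : Measure (Fin n → ℝ) | IsProbabilityMeasure μ ∧
      (∀ k, ∀ᵐ x ∂μ, 0 ≤ x k) ∧ (∑ k, ∫ x, x k ∂μ) ≤ E},
    mutualInfo (misoJoint h v μ)

/-- Joint law of `(X̄, X̄ + Z)` for the unit-gain SISO channel. -/
def sisoJoint (v : ℝ≥0) (μ : Measure ℝ) : Measure (ℝ × ℝ) :=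
  (μ.prod (gaussianReal 0 v)).map (fun p => (p.1, p.1 + p.2))

/-- Unit-gain SISO capacity under peak-power constraint `A` and average-power
constraint `E`. -/
def sisoCapacity (v : ℝ≥0) (A E : ℝ) : EReal :=
  ⨆ μ ∈ {μ : Measure ℝ | IsProbabilityMeasure μ ∧
      (∀ᵐ x ∂μ, x ∈ Set.Icc 0 A) ∧ (∫ x, x ∂μ) ≤ E},
    mutualInfo (sisoJoint v μ)

/-- Unit-gain SISO capacity under only an average-power constraint `E`. -/
def sisoCapacityAvg (v : ℝ≥0) (E : ℝ) : EReal :=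
  ⨆ μ ∈ {μ : Measure ℝ | IsProbabilityMeasure μ ∧
      (∀ᵐ x ∂μ, 0 ≤ x) ∧ (∫ x, x ∂μ) ≤ E},
    mutualInfo (sisoJoint v μ)

/-- The interval `(s_{k-1} A, s_k A]` (with the first one being `[0, s_1 A]`)
corresponding to the event `U = k` (0-indexed: `k ∈ Fin n` stands for `k+1`). -/
def uInterval {n : ℕ} (h : Fin n → ℝ) (A : ℝ) (k : Fin n) : Set ℝ :=
  if k.val = 0 then Set.Icc 0 (sCum h 1 * A)
  else Set.Ioc (sCum h k.val * A) (sCum h (k.val + 1) * A)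

/-- The average input power `∑_k p_k ((E[X̄ | U=k] - A s_{k-1})/h_k + (k-1) A)`
consumed to generate a scalar law of `X̄`. -/
def avgPowerUse {n : ℕ} (h : Fin n → ℝ) (A : ℝ) (μ : Measure ℝ) : ℝ :=
  ∑ k : Fin n,
    (((∫ x in uInterval h A k, x ∂μ) - A * sCum h k.val * (μ (uInterval h A k)).toReal) / h k
      + (k.val : ℝ) * A * (μ (uInterval h A k)).toReal)

/-- The threshold `α_th`. -/
def alphaTh {n : ℕ} (h : Fin n → ℝ) : ℝ :=
  1 / 2 + (1 / sCum h n) * ∑ k : Fin n, h k * (k.val : ℝ)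


end

lemma klDiv_eq_coe {α : Type*} [MeasurableSpace α] (μ ν : Measure α)
    [IsProbabilityMeasure μ] [IsProbabilityMeasure ν] :
    klDiv μ ν = ((InformationTheory.klDiv μ ν : ℝ≥0∞) : EReal) := by
  by_cases hac : μ ≪ ν ∧ Integrable (llr μ ν) μ
  · have h0 := InformationTheory.integral_llr_add_sub_measure_univ_nonneg hac.1 hac.2
    simp only [probReal_univ, add_sub_cancel_right] at h0
    rw [InformationTheory.klDiv_of_ac_of_integrable hac.1 hac.2, klDiv, if_pos hac]
    simp [EReal.coe_ennreal_ofReal, max_eq_left h0]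
  · have : InformationTheory.klDiv μ ν = ∞ :=
      InformationTheory.klDiv_eq_top_iff.2 fun h1 h2 => hac ⟨h1, h2⟩
    rw [klDiv, if_neg hac, this, EReal.coe_ennreal_top]

/-- Among all reference laws with product form, the second marginal minimizes the divergence. -/
lemma informationTheory_klDiv_prod_snd_le {X Y : Type*} [MeasurableSpace X] [MeasurableSpace Y]
    [StandardBorelSpace X] [Nonempty X] (J : Measure (X × Y)) [IsProbabilityMeasure J]
    (ν : Measure Y) [IsProbabilityMeasure ν] :
    InformationTheory.klDiv J (J.fst.prod J.snd) ≤ InformationTheory.klDiv J (J.fst.prod ν) := by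
  have hJ : IsProbabilityMeasure (J.map Prod.swap) :=
    Measure.isProbabilityMeasure_map measurable_swap.aemeasurable
  have hdis : J.snd ⊗ₘ (J.map Prod.swap).condKernel = J.map Prod.swap := by
    rw [← Measure.fst_map_swap]
    exact (J.map Prod.swap).disintegrate _
  calc InformationTheory.klDiv J (J.fst.prod J.snd)
      = InformationTheory.klDiv ((J.map Prod.swap).map Prod.swap)
          ((J.snd.prod J.fst).map Prod.swap) := by
        rw [Measure.prod_swap, Measure.map_map measurable_swap measurable_swap]
        simp
    _ ≤ InformationTheory.klDiv (J.map Prod.swap) (J.snd.prod J.fst) :=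
        InformationTheory.klDiv_map_le _ _ measurable_swap
    _ ≤ InformationTheory.klDiv (J.map Prod.swap) (ν.prod J.fst) := by
        rw [← hdis, ← Measure.compProd_const, ← Measure.compProd_const,
          InformationTheory.klDiv_compProd_eq_add (μ := J.snd) (ν := ν)]
        exact le_add_self
    _ = InformationTheory.klDiv (J.map Prod.swap) ((J.fst.prod ν).map Prod.swap) := by
        rw [Measure.prod_swap]
    _ ≤ InformationTheory.klDiv J (J.fst.prod ν) :=
        InformationTheory.klDiv_map_le _ _ measurable_swap

/-- The Donsker–Varadhan lower bound. -/
lemma integral_sub_log_integral_exp_le_klDiv {α : Type*} [MeasurableSpace α] (μ ν : Measure α)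
    [IsProbabilityMeasure μ] [IsProbabilityMeasure ν] (f : α → ℝ) (hfμ : Integrable f μ)
    (hfν : Integrable (fun x => exp (f x)) ν) :
    ((∫ x, f x ∂μ - log (∫ x, exp (f x) ∂ν) : ℝ) : EReal) ≤ klDiv μ ν := by
  rw [klDiv]
  split_ifs with hac
  · have : IsProbabilityMeasure (ν.tilted f) := isProbabilityMeasure_tilted hfν
    have h1 := integral_llr_tilted_right hac.1 hfμ hfν hac.2
    have h2 := InformationTheory.integral_llr_add_sub_measure_univ_nonneg
      (hac.1.trans (absolutelyContinuous_tilted hfν))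
      (integrable_llr_tilted_right hac.1 hfμ hac.2 hfν)
    simp only [probReal_univ, add_sub_cancel_right] at h2
    exact EReal.coe_le_coe_iff.2 (by linarith)
  · exact le_top

/-- Joint law of the input `X ∼ μ` and the output `w X + Z`, `Z ∼ N(0, v)`. -/
noncomputable def awgnJoint {X : Type*} [MeasurableSpace X] (w : X → ℝ) (v : ℝ≥0)
    (μ : Measure X) : Measure (X × ℝ) :=
  (μ.prod (gaussianReal 0 v)).map (fun p => (p.1, w p.1 + p.2))

section awgn

variable {X : Type*} [MeasurableSpace X] {w : X → ℝ} {v : ℝ≥0} {μ : Measure X}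

lemma isProbabilityMeasure_awgnJoint [IsProbabilityMeasure μ] (hw : Measurable w) :
    IsProbabilityMeasure (awgnJoint w v μ) :=
  Measure.isProbabilityMeasure_map (by fun_prop)

lemma awgnJoint_map_fst [IsProbabilityMeasure μ] (hw : Measurable w) :
    (awgnJoint w v μ).map Prod.fst = μ := by
  rw [awgnJoint, Measure.map_map measurable_fst (by fun_prop)]
  exact (Measure.map_fst_prod (μ := μ) (ν := gaussianReal 0 v)).trans (by simp)

lemma awgnJoint_map_snd (hw : Measurable w) :
    (awgnJoint w v μ).map Prod.snd =
      (μ.prod (gaussianReal 0 v)).map (fun p => w p.1 + p.2) := by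
  rw [awgnJoint, Measure.map_map measurable_snd (by fun_prop)]
  rfl

lemma awgnJoint_eq_withDensity [IsProbabilityMeasure μ] (hw : Measurable w) (hv : v ≠ 0)
    (m : ℝ) :
    awgnJoint w v μ = (μ.prod (gaussianReal m v)).withDensity
      (fun p => ENNReal.ofReal
        (exp (((w p.1 - m) * (p.2 - m) - (w p.1 - m) ^ 2 / 2) / v))) := by
  refine Measure.ext_of_lintegral _ fun g hg => ?_
  have hv' : (v : ℝ) ≠ 0 := by exact_mod_cast hv
  rw [awgnJoint, lintegral_map hg (by fun_prop),
    lintegral_withDensity_eq_lintegral_mul _ (by fun_prop) hg,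
    lintegral_prod _ (by fun_prop), lintegral_prod _ (by fun_prop)]
  refine lintegral_congr fun x => ?_
  have h1 : ∫⁻ z, g (x, w x + z) ∂gaussianReal 0 v = ∫⁻ y, g (x, y) ∂gaussianReal (w x) v := by
    have := gaussianReal_map_const_add (μ := 0) (v := v) (w x)
    rw [zero_add] at this
    rw [← this, lintegral_map (by fun_prop) (by fun_prop)]
  rw [h1, gaussianReal_of_var_ne_zero _ hv, gaussianReal_of_var_ne_zero _ hv,
    lintegral_withDensity_eq_lintegral_mul _ (by fun_prop) (by fun_prop),
    lintegral_withDensity_eq_lintegral_mul _ (by fun_prop) (by fun_prop)]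
  refine lintegral_congr fun y => ?_
  simp only [Pi.mul_apply, gaussianPDF]
  rw [← mul_assoc, ← ENNReal.ofReal_mul (gaussianPDFReal_nonneg _ _ _)]
  congr 2
  simp only [gaussianPDFReal]
  rw [mul_assoc _ (rexp _) (rexp _), ← exp_add]
  congr 2
  field_simp
  ring

variable [IsProbabilityMeasure μ]

lemma integrable_of_abs_sub_le {m B : ℝ} (hw : Measurable w) (hB : ∀ᵐ x ∂μ, |w x - m| ≤ B) :
    Integrable (fun x => w x - m) μ :=
  Integrable.of_bound (by fun_prop) B hB

lemma integrable_sq_of_abs_sub_le {m B : ℝ} (hw : Measurable w)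
    (hB : ∀ᵐ x ∂μ, |w x - m| ≤ B) : Integrable (fun x => (w x - m) ^ 2) μ := by
  refine Integrable.of_bound (by fun_prop) (B ^ 2) ?_
  filter_upwards [hB] with x hx
  rw [norm_pow]
  exact pow_le_pow_left₀ (norm_nonneg _) hx 2

lemma integrable_id_gaussianReal_zero : Integrable (fun z : ℝ => z) (gaussianReal 0 v) :=
  (memLp_id_gaussianReal 1).integrable le_rfl

/-- Quadratic information densities on the joint law of an additive Gaussian channel. -/
lemma integrable_and_integral_awgnJoint {m B : ℝ} (c : ℝ) (hw : Measurable w)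
    (hB : ∀ᵐ x ∂μ, |w x - m| ≤ B) :
    Integrable (fun p => ((w p.1 - m) * (p.2 - m) - c * (w p.1 - m) ^ 2) / v)
        (awgnJoint w v μ) ∧
      ∫ p, ((w p.1 - m) * (p.2 - m) - c * (w p.1 - m) ^ 2) / v ∂awgnJoint w v μ =
        (1 - c) * (∫ x, (w x - m) ^ 2 ∂μ) / v := by
  have hi1 := (integrable_of_abs_sub_le hw hB).mul_prod
    (integrable_id_gaussianReal_zero (v := v))
  have hi2 := ((integrable_sq_of_abs_sub_le hw hB).comp_fst (gaussianReal 0 v)).const_mul (1 - c)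
  have hm : Measurable (fun p : X × ℝ => (p.1, w p.1 + p.2)) := by fun_prop
  have he : (fun p : X × ℝ => ((w p.1 - m) * (w p.1 + p.2 - m) - c * (w p.1 - m) ^ 2) / v) =
      fun p => ((w p.1 - m) * p.2 + (1 - c) * (w p.1 - m) ^ 2) / v := by
    funext p; ring
  constructor
  · rw [awgnJoint, integrable_map_measure (by fun_prop) hm.aemeasurable]
    refine Integrable.congr ((hi1.add hi2).div_const (v : ℝ)) (Eventually.of_forall fun p => ?_)
    exact (congrFun he p).symm
  · rw [awgnJoint, integral_map hm.aemeasurable (by fun_prop)]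
    rw [he, integral_div, integral_add hi1 hi2, integral_const_mul]
    rw [integral_prod_mul (μ := μ) (ν := gaussianReal 0 v) (fun x => w x - m) (fun z => z),
      integral_fun_fst (μ := μ) (ν := gaussianReal 0 v) (fun x => (w x - m) ^ 2)]
    simp

/-- The mutual information of an additive Gaussian channel is at most the second moment of the
signal about any point, divided by twice the noise variance. -/
lemma mutualInfo_awgnJoint_le [StandardBorelSpace X] [Nonempty X] {m B : ℝ} (hw : Measurable w)
    (hv : v ≠ 0) (hB : ∀ᵐ x ∂μ, |w x - m| ≤ B) :
    mutualInfo (awgnJoint w v μ) ≤ (((∫ x, (w x - m) ^ 2 ∂μ) / (2 * v) : ℝ) : EReal) := by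
  have hJ := isProbabilityMeasure_awgnJoint (μ := μ) (v := v) hw
  set R := μ.prod (gaussianReal m v) with hR
  have hdens := awgnJoint_eq_withDensity (μ := μ) hw hv m
  have hac : awgnJoint w v μ ≪ R := by
    rw [hdens]; exact withDensity_absolutelyContinuous _ _
  have hllr : llr (awgnJoint w v μ) R =ᵐ[awgnJoint w v μ]
      fun p => ((w p.1 - m) * (p.2 - m) - (1 / 2) * (w p.1 - m) ^ 2) / v := by
    have h1 := Measure.rnDeriv_withDensity R (f := fun p => ENNReal.ofReal
        (exp (((w p.1 - m) * (p.2 - m) - (w p.1 - m) ^ 2 / 2) / v))) (by fun_prop)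
    rw [← hdens] at h1
    filter_upwards [hac.ae_le h1] with p hp
    rw [llr, hp, ENNReal.toReal_ofReal (exp_pos _).le, log_exp]
    ring
  obtain ⟨hint, hval⟩ := integrable_and_integral_awgnJoint (v := v) (1 / 2) hw hB
  have hfst : (awgnJoint w v μ).fst = μ := awgnJoint_map_fst hw
  have hle := informationTheory_klDiv_prod_snd_le (awgnJoint w v μ) (gaussianReal m v)
  rw [hfst, ← hR, InformationTheory.klDiv_of_ac_of_integrable hac
    ((integrable_congr hllr).2 hint), integral_congr_ae hllr, hval] at hle
  simp only [probReal_univ, add_sub_cancel_right] at hle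
  have : IsProbabilityMeasure (awgnJoint w v μ).snd := inferInstance
  rw [mutualInfo, awgnJoint_map_fst hw]
  change klDiv _ (μ.prod (awgnJoint w v μ).snd) ≤ _
  rw [klDiv_eq_coe]
  refine (EReal.coe_ennreal_le_coe_ennreal_iff.2 hle).trans ?_
  have h0 : 0 ≤ ∫ x, (w x - m) ^ 2 ∂μ := integral_nonneg fun x => sq_nonneg _
  rw [EReal.coe_ennreal_ofReal, max_eq_left (by positivity)]
  refine EReal.coe_le_coe_iff.2 (le_of_eq ?_)
  ring

end awgn

section awgnLower

variable {X : Type*} [MeasurableSpace X] {w : X → ℝ} {v : ℝ≥0} {μ : Measure X}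

lemma ae_prod_abs_le {m B : ℝ} (hB : ∀ᵐ x ∂μ, |w x - m| ≤ B) :
    ∀ᵐ p ∂μ.prod μ, |w p.1 - m| ≤ B ∧ |w p.2 - m| ≤ B :=
  (Measure.quasiMeasurePreserving_fst.ae hB).and (Measure.quasiMeasurePreserving_snd.ae hB)

variable [IsProbabilityMeasure μ]

lemma prod_awgnJoint_map_snd (hw : Measurable w) :
    μ.prod ((awgnJoint w v μ).map Prod.snd) =
      ((μ.prod μ).prod (gaussianReal 0 v)).map (fun p => (p.1.1, w p.1.2 + p.2)) := by
  have h1 : μ.prod ((awgnJoint w v μ).map Prod.snd) =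
      (μ.prod (μ.prod (gaussianReal 0 v))).map
        (Prod.map id (fun p : X × ℝ => w p.1 + p.2)) := by
    rw [awgnJoint_map_snd hw, ← Measure.map_prod_map _ _ measurable_id (by fun_prop),
      Measure.map_id]
  rw [h1, ← Measure.prodAssoc_prod, Measure.map_map (by fun_prop) (by fun_prop)]
  rfl

lemma integrable_exp_shifted {m B : ℝ} (hw : Measurable w) (hB : ∀ᵐ x ∂μ, |w x - m| ≤ B) :
    Integrable (fun p : (X × X) × ℝ => exp ((w p.1.1 - m) * (w p.1.2 + p.2 - m) / v))
      ((μ.prod μ).prod (gaussianReal 0 v)) := by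
  have hdom : Integrable
      (fun z : ℝ => exp (B * B / v) * (exp (B / v * z) + exp (-(B / v) * z)))
      (gaussianReal 0 v) :=
    ((integrable_exp_mul_gaussianReal _).add (integrable_exp_mul_gaussianReal _)).const_mul _
  refine Integrable.mono' (hdom.comp_snd (μ.prod μ)) (by fun_prop) ?_
  filter_upwards [Measure.quasiMeasurePreserving_fst.ae (ae_prod_abs_le hB)] with p ⟨h1, h2⟩
  have hB0 : 0 ≤ B := (abs_nonneg _).trans h1
  rw [norm_of_nonneg (exp_pos _).le]
  have e1 : (w p.1.1 - m) * (w p.1.2 + p.2 - m) / v ≤ B * B / v + B / v * |p.2| := by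
    have ha : (w p.1.1 - m) * (w p.1.2 - m) ≤ B * B :=
      (le_abs_self _).trans (by rw [abs_mul]; gcongr)
    have hb : (w p.1.1 - m) * p.2 ≤ B * |p.2| :=
      (le_abs_self _).trans (by rw [abs_mul]; gcongr)
    calc (w p.1.1 - m) * (w p.1.2 + p.2 - m) / v
        = ((w p.1.1 - m) * (w p.1.2 - m) + (w p.1.1 - m) * p.2) / v := by ring
      _ ≤ (B * B + B * |p.2|) / v := by gcongr
      _ = _ := by ring
  refine (exp_le_exp.2 e1).trans ?_
  rw [exp_add]
  refine mul_le_mul_of_nonneg_left ?_ (exp_pos _).le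
  rcases abs_cases p.2 with ⟨h, _⟩ | ⟨h, _⟩
  · rw [h]; linarith [exp_pos (-(B / v) * p.2)]
  · rw [h, show B / v * -p.2 = -(B / v) * p.2 by ring]; linarith [exp_pos (B / v * p.2)]

lemma integral_exp_shifted_le {m B : ℝ} (hw : Measurable w) (hv : v ≠ 0)
    (hm : m = ∫ x, w x ∂μ) (hB : ∀ᵐ x ∂μ, |w x - m| ≤ B) (hB1 : 3 * B ^ 2 / (2 * v) ≤ 1) :
    ∫ p : (X × X) × ℝ, exp ((w p.1.1 - m) * (w p.1.2 + p.2 - m) / v)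
        ∂((μ.prod μ).prod (gaussianReal 0 v)) ≤
      1 + (∫ x, (w x - m) ^ 2 ∂μ) / (2 * v) + (3 * B ^ 2 / (2 * v)) ^ 2 := by
  have hv' : (v : ℝ) ≠ 0 := by exact_mod_cast hv
  set t : X × X → ℝ := fun p =>
    (w p.1 - m) * (w p.2 - m) / v + (w p.1 - m) ^ 2 / (2 * v) with ht
  have hinner : ∀ p : X × X,
      ∫ z, exp ((w p.1 - m) * (w p.2 + z - m) / v) ∂gaussianReal 0 v = exp (t p) := by
    intro p
    have h1 := congrFun (mgf_id_gaussianReal (μ := 0) (v := v)) ((w p.1 - m) / v)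
    simp only [mgf, id] at h1
    have h2 : ∀ z, exp ((w p.1 - m) * (w p.2 + z - m) / v) =
        exp ((w p.1 - m) * (w p.2 - m) / v) * exp ((w p.1 - m) / v * z) := by
      intro z
      rw [← exp_add]
      congr 1
      ring
    simp_rw [h2]
    rw [integral_const_mul, h1, ← exp_add]
    congr 1
    simp only [ht]
    field_simp
    ring
  rw [integral_prod _ (integrable_exp_shifted hw hB)]
  simp only [hinner]
  have hbd : ∀ᵐ p ∂μ.prod μ, |t p| ≤ 3 * B ^ 2 / (2 * v) := by
    filter_upwards [ae_prod_abs_le hB] with p ⟨h1, h2⟩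
    have hB0 : 0 ≤ B := (abs_nonneg _).trans h1
    calc |t p| ≤ |(w p.1 - m) * (w p.2 - m) / v| + |(w p.1 - m) ^ 2 / (2 * v)| := abs_add_le _ _
      _ = |w p.1 - m| * |w p.2 - m| / v + |w p.1 - m| ^ 2 / (2 * v) := by
        rw [abs_div, abs_div, abs_mul, abs_pow, abs_of_nonneg v.coe_nonneg,
          abs_of_nonneg (by positivity : (0 : ℝ) ≤ 2 * v)]
      _ ≤ B * B / v + B ^ 2 / (2 * v) := by gcongr
      _ = _ := by field_simp; ring
  have htm : Measurable t := by fun_prop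
  have hti : Integrable t (μ.prod μ) := Integrable.of_bound (by fun_prop) _ hbd
  have hi1 := (integrable_of_abs_sub_le hw hB).mul_prod (integrable_of_abs_sub_le hw hB)
  have hi2 := (integrable_sq_of_abs_sub_le hw hB).comp_fst μ
  have hwi : Integrable w μ := by
    refine Integrable.of_bound (by fun_prop) (B + |m|) ?_
    filter_upwards [hB] with x hx
    have := abs_add_le (w x - m) m
    rw [sub_add_cancel] at this
    exact this.trans (by gcongr)
  have hzero : ∫ x, (w x - m) ∂μ = 0 := by
    rw [integral_sub hwi (integrable_const _), ← hm]; simp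
  have htint : ∫ p, t p ∂μ.prod μ = (∫ x, (w x - m) ^ 2 ∂μ) / (2 * v) := by
    simp only [ht]
    rw [integral_add (hi1.div_const _) (hi2.div_const _), integral_div, integral_div,
      integral_prod_mul (μ := μ) (ν := μ) (fun x => w x - m) (fun x => w x - m), hzero,
      integral_fun_fst (μ := μ) (ν := μ) (fun x => (w x - m) ^ 2)]
    simp
  calc ∫ p, exp (t p) ∂μ.prod μ
      ≤ ∫ p, ((1 + t p) + (3 * B ^ 2 / (2 * v)) ^ 2) ∂μ.prod μ := by
        refine integral_mono_of_nonneg (Eventually.of_forall fun p => (exp_pos _).le)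
          (((integrable_const _).add hti).add (integrable_const _)) ?_
        filter_upwards [hbd] with p hp
        have h1 := (abs_le.1 (abs_exp_sub_one_sub_id_le (hp.trans hB1))).2
        have h2 : t p ^ 2 ≤ (3 * B ^ 2 / (2 * v)) ^ 2 := by
          rw [← sq_abs (t p)]
          exact pow_le_pow_left₀ (abs_nonneg _) hp 2
        linarith
    _ = _ := by
        have h1 : Integrable (fun p => 1 + t p) (μ.prod μ) := (integrable_const _).add hti
        rw [integral_add h1 (integrable_const _), integral_add (integrable_const _) hti, htint]
        simp

/-- At low signal power the mutual information of an additive Gaussian channel agrees with the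
signal variance over twice the noise variance up to fourth order. -/
lemma le_mutualInfo_awgnJoint {m B : ℝ} (hw : Measurable w) (hv : v ≠ 0)
    (hm : m = ∫ x, w x ∂μ) (hB : ∀ᵐ x ∂μ, |w x - m| ≤ B) (hB1 : 3 * B ^ 2 / (2 * v) ≤ 1) :
    (((∫ x, (w x - m) ^ 2 ∂μ) / (2 * v) - (3 * B ^ 2 / (2 * v)) ^ 2 : ℝ) : EReal) ≤
      mutualInfo (awgnJoint w v μ) := by
  have hJ := isProbabilityMeasure_awgnJoint (μ := μ) (v := v) hw
  have hJ2 : IsProbabilityMeasure ((awgnJoint w v μ).map Prod.snd) :=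
    Measure.isProbabilityMeasure_map (by fun_prop)
  obtain ⟨hint, hval⟩ := integrable_and_integral_awgnJoint (v := v) 0 hw hB
  simp only [zero_mul, sub_zero, one_mul] at hint hval
  have hexp := integrable_exp_shifted (v := v) hw hB
  have hmap : Measurable (fun p : (X × X) × ℝ => (p.1.1, w p.1.2 + p.2)) := by fun_prop
  have hDV := integral_sub_log_integral_exp_le_klDiv (awgnJoint w v μ)
    (μ.prod ((awgnJoint w v μ).map Prod.snd)) _ hint (by
      rw [prod_awgnJoint_map_snd hw, integrable_map_measure (by fun_prop) hmap.aemeasurable]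
      exact hexp)
  rw [mutualInfo, awgnJoint_map_fst hw]
  refine le_trans (EReal.coe_le_coe_iff.2 ?_) hDV
  rw [hval, prod_awgnJoint_map_snd hw, integral_map hmap.aemeasurable (by fun_prop)]
  have hle := integral_exp_shifted_le hw hv hm hB hB1
  have hpos := integral_exp_pos hexp
  have hlog := log_le_sub_one_of_pos hpos
  have hv' : (v : ℝ) ≠ 0 := by exact_mod_cast hv
  have : (∫ x, (w x - m) ^ 2 ∂μ) / v = 2 * ((∫ x, (w x - m) ^ 2 ∂μ) / (2 * v)) := by
    field_simp
  beta_reduce at hle hlog ⊢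
  linarith

end awgnLower

section greedy

variable {n : ℕ} {h : Fin n → ℝ}

lemma sCum_zero (h : Fin n → ℝ) : sCum h 0 = 0 := by simp [sCum]

lemma sCum_self (h : Fin n → ℝ) : sCum h n = ∑ i, h i := by simp [sCum]

lemma sCum_succ (h : Fin n → ℝ) {k : ℕ} (hk : k < n) :
    sCum h (k + 1) = sCum h k + h ⟨k, hk⟩ := by
  have h1 : ∀ i : Fin n, (if i.val < k + 1 then h i else 0) =
      (if i.val < k then h i else 0) + (if i = ⟨k, hk⟩ then h i else 0) := by
    intro i
    by_cases h1 : i.val < k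
    · simp [h1, Fin.ext_iff, h1.ne, Nat.lt_succ_of_lt h1]
    · by_cases h2 : i.val = k
      · simp [Fin.ext_iff, h2]
      · have : ¬ i.val < k + 1 := by omega
        simp [Fin.ext_iff, h2, h1, this]
  simp only [sCum, h1, Finset.sum_add_distrib]
  simp

lemma sCum_mono (hpos : ∀ k, 0 < h k) : Monotone (sCum h) := by
  intro a b hab
  refine Finset.sum_le_sum fun i _ => ?_
  split_ifs with h1 h2
  · exact le_rfl
  · exact absurd (h1.trans_le hab) h2
  · exact (hpos i).le
  · exact le_rfl

/-- Normalized level of the `k`-th LED when the signal `w` is produced by switching on the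
LEDs one after the other, strongest first. -/
noncomputable def greedyLevel (h : Fin n → ℝ) (k : ℕ) (w : ℝ) : ℝ :=
  if hk : k < n then (min w (sCum h (k + 1)) - min w (sCum h k)) / h ⟨k, hk⟩ else 0

lemma continuous_greedyLevel (k : ℕ) : Continuous (greedyLevel h k) := by
  unfold greedyLevel
  split_ifs
  · exact ((continuous_id.min continuous_const).sub
      (continuous_id.min continuous_const)).div_const _
  · exact continuous_const

lemma greedyLevel_nonneg (hpos : ∀ k, 0 < h k) (k : ℕ) (w : ℝ) : 0 ≤ greedyLevel h k w := by
  unfold greedyLevel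
  split_ifs
  · exact div_nonneg (sub_nonneg.2 (min_le_min_left _ (sCum_mono hpos k.le_succ))) (hpos _).le
  · exact le_rfl

lemma greedyLevel_le_one (hpos : ∀ k, 0 < h k) (k : ℕ) (w : ℝ) : greedyLevel h k w ≤ 1 := by
  unfold greedyLevel
  split_ifs with hk
  · rw [div_le_one (hpos _), sub_le_iff_le_add', sCum_succ h hk]
    rcases min_choice w (sCum h k) with h1 | h1 <;> rw [h1]
    · exact (min_le_left _ _).trans (by linarith [hpos ⟨k, hk⟩])
    · exact min_le_right _ _
  · exact zero_le_one

lemma greedyLevel_eq_zero (hpos : ∀ k, 0 < h k) {k : ℕ} {w : ℝ} (hw : w ≤ sCum h k) :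
    greedyLevel h k w = 0 := by
  unfold greedyLevel
  split_ifs with hk
  · rw [min_eq_left hw, min_eq_left (hw.trans (sCum_mono hpos k.le_succ)), sub_self, zero_div]
  · rfl

lemma greedyLevel_eq_one (hpos : ∀ k, 0 < h k) {k : ℕ} (hk : k < n) {w : ℝ}
    (hw : sCum h (k + 1) ≤ w) : greedyLevel h k w = 1 := by
  rw [greedyLevel, dif_pos hk, min_eq_right hw,
    min_eq_right ((sCum_mono hpos k.le_succ).trans hw), sCum_succ h hk, add_sub_cancel_left,
    div_self (hpos _).ne']

lemma greedyLevel_last (w : ℝ) : greedyLevel h n w = 0 := by simp [greedyLevel]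

lemma sub_mul_greedyLevel (hpos : ∀ k, 0 < h k) {k : ℕ} (hk : k < n) (w : ℝ) :
    (sCum h (k + 1) - sCum h k) * greedyLevel h k w =
      min w (sCum h (k + 1)) - min w (sCum h k) := by
  rw [greedyLevel, dif_pos hk, sCum_succ h hk, add_sub_cancel_left,
    mul_div_cancel₀ _ (hpos _).ne']

lemma greedyLevel_succ_le (hpos : ∀ k, 0 < h k) {k : ℕ} (hk : k < n) (w : ℝ) :
    greedyLevel h (k + 1) w ≤ greedyLevel h k w := by
  rcases le_total w (sCum h (k + 1)) with hw | hw
  · rw [greedyLevel_eq_zero hpos hw]; exact greedyLevel_nonneg hpos _ _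
  · rw [greedyLevel_eq_one hpos hk hw]; exact greedyLevel_le_one hpos _ _

/-- Summation by parts. -/
lemma sum_succ_mul_sub (f c : ℕ → ℝ) (n : ℕ) :
    ∑ k : Fin n, f (k.val + 1) * (c k.val - c (k.val + 1)) =
      ∑ k ∈ Finset.range n, (f (k + 1) - f k) * c k + f 0 * c 0 - f n * c n := by
  rw [Fin.sum_univ_eq_sum_range (fun k => f (k + 1) * (c k - c (k + 1)))]
  induction n with
  | zero => simp
  | succ n ih => rw [Finset.sum_range_succ, Finset.sum_range_succ, ih]; ring

/-- Probability that the first `k + 1` LEDs are on when the signal `w` is generated by randomizing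
between neighbouring values of `sCum h`. -/
noncomputable def hatWeight (h : Fin n → ℝ) (k : Fin n) (w : ℝ) : ℝ :=
  greedyLevel h k.val w - greedyLevel h (k.val + 1) w

lemma hatWeight_nonneg (hpos : ∀ k, 0 < h k) (k : Fin n) (w : ℝ) : 0 ≤ hatWeight h k w :=
  sub_nonneg.2 (greedyLevel_succ_le hpos k.2 w)

lemma hatWeight_le_one (hpos : ∀ k, 0 < h k) (k : Fin n) (w : ℝ) : hatWeight h k w ≤ 1 := by
  have h1 := greedyLevel_le_one hpos k.val w
  have h2 := greedyLevel_nonneg hpos (k.val + 1) w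
  rw [hatWeight]; linarith

lemma continuous_hatWeight (k : Fin n) : Continuous (hatWeight h k) :=
  (continuous_greedyLevel _).sub (continuous_greedyLevel _)

lemma sum_hatWeight_le_one (hpos : ∀ k, 0 < h k) (w : ℝ) : ∑ k, hatWeight h k w ≤ 1 := by
  have h1 := sum_succ_mul_sub (fun _ => 1) (fun k => greedyLevel h k w) n
  simp only [one_mul, sub_self, zero_mul, Finset.sum_const_zero, zero_add, greedyLevel_last,
    sub_zero] at h1
  exact h1.trans_le (greedyLevel_le_one hpos _ _)

lemma sum_sCum_mul_hatWeight (hpos : ∀ k, 0 < h k) {w : ℝ} (h0 : 0 ≤ w) (hn : w ≤ sCum h n) :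
    ∑ k : Fin n, sCum h (k.val + 1) * hatWeight h k w = w := by
  have h1 := sum_succ_mul_sub (sCum h) (fun k => greedyLevel h k w) n
  rw [greedyLevel_last, sCum_zero, Finset.sum_congr rfl fun k hk =>
    sub_mul_greedyLevel hpos (Finset.mem_range.1 hk) w,
    Finset.sum_range_sub (fun k => min w (sCum h k)), sCum_zero, min_eq_left hn,
    min_eq_right h0] at h1
  simpa [hatWeight] using h1

lemma sq_le_sum_sCum_sq_mul_hatWeight (hpos : ∀ k, 0 < h k) {w : ℝ} (h0 : 0 ≤ w)
    (hn : w ≤ sCum h n) :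
    w ^ 2 ≤ ∑ k : Fin n, sCum h (k.val + 1) ^ 2 * hatWeight h k w := by
  have h1 := sum_succ_mul_sub (fun k => sCum h k ^ 2) (fun k => greedyLevel h k w) n
  simp only [greedyLevel_last, sCum_zero, ne_eq, OfNat.ofNat_ne_zero, not_false_eq_true, zero_pow,
    zero_mul, mul_zero, add_zero, sub_zero] at h1
  simp only [hatWeight]
  rw [h1]
  have h2 : w ^ 2 = ∑ k ∈ Finset.range n,
      (min w (sCum h (k + 1)) ^ 2 - min w (sCum h k) ^ 2) := by
    rw [Finset.sum_range_sub (fun k => min w (sCum h k) ^ 2), sCum_zero, min_eq_left hn,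
      min_eq_right h0]
    ring
  rw [h2]
  refine Finset.sum_le_sum fun k hk => ?_
  have h3 := sub_mul_greedyLevel hpos (Finset.mem_range.1 hk) w
  have h4 : 0 ≤ min w (sCum h (k + 1)) - min w (sCum h k) :=
    sub_nonneg.2 (min_le_min_left _ (sCum_mono hpos k.le_succ))
  calc min w (sCum h (k + 1)) ^ 2 - min w (sCum h k) ^ 2
      = (min w (sCum h (k + 1)) + min w (sCum h k)) *
          (min w (sCum h (k + 1)) - min w (sCum h k)) := by ring
    _ ≤ (sCum h (k + 1) + sCum h k) * (min w (sCum h (k + 1)) - min w (sCum h k)) := by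
        gcongr <;> exact min_le_right _ _
    _ = _ := by rw [← h3]; ring

/-- Switching on the strongest LEDs first minimizes the total power for a given signal. -/
lemma sum_succ_mul_hatWeight_le (hord : ∀ i j : Fin n, i ≤ j → h j ≤ h i) (hpos : ∀ k, 0 < h k)
    (u : Fin n → ℝ) (hu : ∀ k, u k ∈ Set.Icc 0 1) :
    ∑ k : Fin n, ((k.val : ℝ) + 1) * hatWeight h k (∑ k, h k * u k) ≤ ∑ k, u k := by
  set w := ∑ k, h k * u k with hw
  have h0 : 0 ≤ w := Finset.sum_nonneg fun k _ => mul_nonneg (hpos k).le (hu k).1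
  have hn : w ≤ sCum h n := by
    rw [sCum_self]
    exact Finset.sum_le_sum fun k _ => mul_le_of_le_one_right (hpos k).le (hu k).2
  have h1 := sum_succ_mul_sub (fun k => (k : ℝ)) (fun k => greedyLevel h k w) n
  simp only [Nat.cast_add, Nat.cast_one, add_sub_cancel_left, one_mul, Nat.cast_zero, zero_mul,
    add_zero, greedyLevel_last, mul_zero, sub_zero,
    ← Fin.sum_univ_eq_sum_range (fun k => greedyLevel h k w)] at h1
  simp only [hatWeight]
  rw [h1]
  rcases Nat.eq_zero_or_pos n with rfl | hn0
  · simp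
  have hex : ∃ k, w ≤ sCum h (k + 1) := ⟨n - 1, by rwa [Nat.sub_add_cancel hn0]⟩
  obtain ⟨k₀, hk₀n, hk₀, hmin⟩ : ∃ k₀, k₀ < n ∧ w ≤ sCum h (k₀ + 1) ∧
      ∀ k < k₀, sCum h (k + 1) < w := by
    refine ⟨Nat.find hex, ?_, Nat.find_spec hex, fun k hk => not_le.1 (Nat.find_min hex hk)⟩
    have : Nat.find hex ≤ n - 1 := Nat.find_min' hex (by rwa [Nat.sub_add_cancel hn0])
    omega
  have hsum : ∑ k : Fin n, h k * greedyLevel h k.val w = w := by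
    have h3 := sum_sCum_mul_hatWeight hpos h0 hn
    have h2 := sum_succ_mul_sub (sCum h) (fun k => greedyLevel h k w) n
    rw [greedyLevel_last, sCum_zero, mul_zero, zero_mul, sub_zero, add_zero,
      ← Fin.sum_univ_eq_sum_range
        (fun k => (sCum h (k + 1) - sCum h k) * greedyLevel h k w)] at h2
    simp only [hatWeight] at h3
    refine (Finset.sum_congr rfl fun k _ => ?_).trans (h2.symm.trans h3)
    rw [sCum_succ h k.2, add_sub_cancel_left]
  have hterm : ∑ k : Fin n, (h k - h ⟨k₀, hk₀n⟩) * (u k - greedyLevel h k.val w) ≤ 0 := by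
    refine Finset.sum_nonpos fun k _ => ?_
    rcases lt_trichotomy k.val k₀ with hk | hk | hk
    · rw [greedyLevel_eq_one hpos k.2 (hmin k hk).le]
      exact mul_nonpos_of_nonneg_of_nonpos
        (sub_nonneg.2 (hord _ _ (Fin.le_def.2 hk.le))) (sub_nonpos.2 (hu k).2)
    · rw [show (⟨k₀, hk₀n⟩ : Fin n) = k from Fin.ext hk.symm, sub_self, zero_mul]
    · rw [greedyLevel_eq_zero hpos (hk₀.trans (sCum_mono hpos hk)), sub_zero]
      exact mul_nonpos_of_nonpos_of_nonneg
        (sub_nonpos.2 (hord _ _ (Fin.le_def.2 hk.le))) (hu k).1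
  have hexp : ∑ k : Fin n, (h k - h ⟨k₀, hk₀n⟩) * (u k - greedyLevel h k.val w) =
      -(h ⟨k₀, hk₀n⟩ * (∑ k, u k - ∑ k : Fin n, greedyLevel h k.val w)) := by
    have : ∀ k : Fin n, (h k - h ⟨k₀, hk₀n⟩) * (u k - greedyLevel h k.val w) =
        (h k * u k - h k * greedyLevel h k.val w) -
          (h ⟨k₀, hk₀n⟩ * (u k - greedyLevel h k.val w)) := fun k => by ring
    simp only [this, Finset.sum_sub_distrib, ← Finset.mul_sum]
    rw [hsum, ← hw]
    ring
  rw [hexp, neg_nonpos] at hterm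
  exact sub_nonneg.1 (nonneg_of_mul_nonneg_right hterm (hpos _))

end greedy

section variance

variable {n : ℕ} {h : Fin n → ℝ} {A : ℝ} {μ : Measure (Fin n → ℝ)}

/-- Variance of the normalized signal when the first `k + 1` LEDs are on with probability
`q k`. -/
noncomputable def signalVariance (h : Fin n → ℝ) (q : Fin n → ℝ) : ℝ :=
  ∑ k : Fin n, (sCum h (k.val + 1)) ^ 2 * q k - (∑ k : Fin n, sCum h (k.val + 1) * q k) ^ 2

lemma signal_mem_Icc (hpos : ∀ k, 0 < h k) {x : Fin n → ℝ} (hx : ∀ k, x k ∈ Set.Icc 0 A) :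
    ∑ k, h k * x k ∈ Set.Icc 0 (A * sCum h n) := by
  constructor
  · exact Finset.sum_nonneg fun k _ => mul_nonneg (hpos k).le (hx k).1
  · rw [sCum_self, Finset.mul_sum]
    exact Finset.sum_le_sum fun k _ => by
      rw [mul_comm]; exact mul_le_mul_of_nonneg_right (hx k).2 (hpos k).le

variable [IsProbabilityMeasure μ]

lemma integrable_signal (hpos : ∀ k, 0 < h k) (hμ : ∀ k, ∀ᵐ x ∂μ, x k ∈ Set.Icc 0 A) :
    Integrable (fun x => ∑ k, h k * x k) μ := by
  refine Integrable.of_bound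
    (Measurable.aestronglyMeasurable (by fun_prop)) (A * sCum h n) ?_
  filter_upwards [ae_all_iff.2 hμ] with x hx
  have := signal_mem_Icc hpos hx
  rw [norm_of_nonneg this.1]
  exact this.2

lemma integrable_signal_sq (hpos : ∀ k, 0 < h k) (hμ : ∀ k, ∀ᵐ x ∂μ, x k ∈ Set.Icc 0 A) :
    Integrable (fun x => (∑ k, h k * x k) ^ 2) μ := by
  refine Integrable.of_bound
    (Measurable.aestronglyMeasurable (by fun_prop)) ((A * sCum h n) ^ 2) ?_
  filter_upwards [ae_all_iff.2 hμ] with x hx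
  have := signal_mem_Icc hpos hx
  rw [norm_pow, norm_of_nonneg this.1]
  exact pow_le_pow_left₀ this.1 this.2 2

lemma ae_abs_signal_sub_le (hpos : ∀ k, 0 < h k) (hμ : ∀ k, ∀ᵐ x ∂μ, x k ∈ Set.Icc 0 A) :
    ∀ᵐ x ∂μ, |∑ k, h k * x k - ∫ y, ∑ k, h k * y k ∂μ| ≤ A * sCum h n := by
  have hae : ∀ᵐ x ∂μ, ∑ k, h k * x k ∈ Set.Icc 0 (A * sCum h n) := by
    filter_upwards [ae_all_iff.2 hμ] with x hx using signal_mem_Icc hpos hx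
  have h1 : 0 ≤ ∫ y, ∑ k, h k * y k ∂μ :=
    integral_nonneg_of_ae (hae.mono fun x hx => hx.1)
  have h2 : ∫ y, ∑ k, h k * y k ∂μ ≤ A * sCum h n := by
    have := integral_mono_ae (integrable_signal hpos hμ) (integrable_const (A * sCum h n))
      (hae.mono fun x hx => hx.2)
    simpa using this
  filter_upwards [hae] with x hx
  exact abs_sub_le_of_nonneg_of_le hx.1 hx.2 h1 h2

/-- Every admissible input law is dominated, in signal variance, by randomized switching of the
strongest LEDs under the same power budget. -/
lemma exists_weights_variance_le (hord : ∀ i j : Fin n, i ≤ j → h j ≤ h i)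
    (hpos : ∀ k, 0 < h k) (hA : 0 < A) (hμ : ∀ k, ∀ᵐ x ∂μ, x k ∈ Set.Icc 0 A) {α : ℝ}
    (hα : ∑ k, ∫ x, x k ∂μ ≤ α * A) :
    ∃ q : Fin n → ℝ, (∀ k, 0 ≤ q k) ∧ ∑ k, q k ≤ 1 ∧
      ∑ k : Fin n, ((k.val : ℝ) + 1) * q k ≤ α ∧
      ∫ x, (∑ k, h k * x k - ∫ y, ∑ k, h k * y k ∂μ) ^ 2 ∂μ ≤ A ^ 2 * signalVariance h q := by
  have hA' : A ≠ 0 := hA.ne'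
  have hint : ∀ k, Integrable (fun x : Fin n → ℝ => hatWeight h k ((∑ k, h k * x k) / A)) μ := by
    intro k
    refine Integrable.of_bound ?_ 1 (Eventually.of_forall fun x => ?_)
    · exact (((continuous_hatWeight k).comp (by fun_prop)).measurable).aestronglyMeasurable
    · rw [norm_of_nonneg (hatWeight_nonneg hpos k _)]
      exact hatWeight_le_one hpos k _
  have hsum : ∀ c : Fin n → ℝ,
      ∑ k, c k * ∫ x, hatWeight h k ((∑ k, h k * x k) / A) ∂μ =
        ∫ x, ∑ k, c k * hatWeight h k ((∑ k, h k * x k) / A) ∂μ := by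
    intro c
    rw [integral_finsetSum _ fun k _ => (hint k).const_mul _]
    simp only [integral_const_mul]
  have hintsum : ∀ c : Fin n → ℝ,
      Integrable (fun x => ∑ k, c k * hatWeight h k ((∑ k, h k * x k) / A)) μ :=
    fun c => integrable_finsetSum _ fun k _ => (hint k).const_mul _
  have hae : ∀ᵐ x ∂μ, (∑ k, h k * x k) / A ∈ Set.Icc 0 (sCum h n) := by
    filter_upwards [ae_all_iff.2 hμ] with x hx
    have := signal_mem_Icc hpos hx
    exact ⟨div_nonneg this.1 hA.le, (div_le_iff₀' hA).2 this.2⟩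
  refine ⟨fun k => ∫ x, hatWeight h k ((∑ k, h k * x k) / A) ∂μ,
    fun k => integral_nonneg fun x => hatWeight_nonneg hpos k _, ?_, ?_, ?_⟩
  · have h1 := hsum fun _ => 1
    simp only [one_mul] at h1
    rw [h1]
    have h2 := integral_mono (μ := μ) (by simpa using hintsum fun _ => 1) (integrable_const (1 : ℝ))
      fun x : Fin n → ℝ => sum_hatWeight_le_one hpos ((∑ k, h k * x k) / A)
    simpa using h2
  · rw [hsum fun k => (k.val : ℝ) + 1]
    have hx : ∀ k, Integrable (fun x : Fin n → ℝ => x k) μ := by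
      intro k
      refine Integrable.of_bound (measurable_pi_apply k).aestronglyMeasurable A ?_
      filter_upwards [hμ k] with x hx
      rw [norm_of_nonneg hx.1]
      exact hx.2
    have hx2 : Integrable (fun x : Fin n → ℝ => ∑ k, x k / A) μ :=
      integrable_finsetSum _ fun k _ => (hx k).div_const _
    have h1 : ∫ x, ∑ k : Fin n, ((k.val : ℝ) + 1) * hatWeight h k ((∑ k, h k * x k) / A) ∂μ ≤
        ∫ x, ∑ k, x k / A ∂μ := by
      refine integral_mono_ae (hintsum _) hx2 ?_
      filter_upwards [ae_all_iff.2 hμ] with x hx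
      have := sum_succ_mul_hatWeight_le hord hpos (fun k => x k / A)
        fun k => ⟨div_nonneg (hx k).1 hA.le, (div_le_one hA).2 (hx k).2⟩
      simpa only [Finset.sum_div, mul_div_assoc] using this
    refine h1.trans ?_
    rw [integral_finsetSum _ fun k _ => (hx k).div_const _]
    simp only [integral_div]
    rw [← Finset.sum_div]
    exact (div_le_iff₀ hA).2 hα
  · have hw := integrable_signal hpos hμ
    have hw2 := integrable_signal_sq hpos hμ
    have hmean : ∫ y, ∑ k, h k * y k ∂μ =
        A * ∫ x, ∑ k : Fin n, sCum h (k.val + 1) *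
          hatWeight h k ((∑ k, h k * x k) / A) ∂μ := by
      rw [← integral_const_mul]
      refine integral_congr_ae ?_
      filter_upwards [hae] with x hx
      rw [sum_sCum_mul_hatWeight hpos hx.1 hx.2, mul_div_cancel₀ _ hA']
    have hsq : ∫ y, (∑ k, h k * y k) ^ 2 ∂μ ≤
        A ^ 2 * ∫ x, ∑ k : Fin n, sCum h (k.val + 1) ^ 2 *
          hatWeight h k ((∑ k, h k * x k) / A) ∂μ := by
      rw [← integral_const_mul]
      refine integral_mono_ae hw2 ((hintsum _).const_mul _) ?_
      filter_upwards [hae] with x hx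
      have := sq_le_sum_sCum_sq_mul_hatWeight hpos hx.1 hx.2
      calc (∑ k, h k * x k) ^ 2 = A ^ 2 * ((∑ k, h k * x k) / A) ^ 2 := by field_simp
        _ ≤ _ := by gcongr
    have hvar : ∀ m : ℝ, m = ∫ y, ∑ k, h k * y k ∂μ →
        ∫ x, (∑ k, h k * x k - m) ^ 2 ∂μ = ∫ y, (∑ k, h k * y k) ^ 2 ∂μ - m ^ 2 := by
      intro m hm
      have : ∀ x : Fin n → ℝ, (∑ k, h k * x k - m) ^ 2 =
          (∑ k, h k * x k) ^ 2 - (2 * m * (∑ k, h k * x k) - m ^ 2) := fun x => by ring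
      simp only [this]
      have hlin : Integrable (fun x : Fin n → ℝ => 2 * m * (∑ k, h k * x k) - m ^ 2) μ :=
        (hw.const_mul _).sub (integrable_const _)
      rw [integral_sub hw2 hlin,
        integral_sub (hw.const_mul _) (integrable_const _), integral_const_mul, ← hm]
      simp
      ring
    rw [hvar _ rfl, signalVariance, hsum, hsum, hmean]
    linarith

end variance

section staircase

variable {n : ℕ} {A : ℝ} {q : Fin n → ℝ}

/-- Law of the input switching on, at full power `A`, the first `k + 1` LEDs with probability
`q k`, and no LED otherwise. -/
noncomputable def staircaseLaw (A : ℝ) (q : Fin n → ℝ) : Measure (Fin n → ℝ) :=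
  ENNReal.ofReal (1 - ∑ k, q k) • Measure.dirac 0 +
    ∑ k, ENNReal.ofReal (q k) • Measure.dirac (fun i => if i ≤ k then A else 0)

lemma isProbabilityMeasure_staircaseLaw (hq : ∀ k, 0 ≤ q k) (hq1 : ∑ k, q k ≤ 1) :
    IsProbabilityMeasure (staircaseLaw A q) := by
  refine ⟨?_⟩
  simp only [staircaseLaw, Measure.add_apply, Measure.smul_apply, Measure.finsetSum_apply,
    measure_univ, smul_eq_mul, mul_one]
  rw [← ENNReal.ofReal_sum_of_nonneg fun k _ => hq k,
    ← ENNReal.ofReal_add (sub_nonneg.2 hq1) (Finset.sum_nonneg fun k _ => hq k)]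
  simp

lemma staircaseLaw_mem_Icc (hA : 0 ≤ A) (k : Fin n) :
    ∀ᵐ x ∂staircaseLaw A q, x k ∈ Set.Icc 0 A := by
  have hm : MeasurableSet {x : Fin n → ℝ | x k ∈ Set.Icc 0 A}ᶜ :=
    ((measurable_pi_apply k) measurableSet_Icc).compl
  rw [ae_iff]
  change staircaseLaw A q {x : Fin n → ℝ | x k ∈ Set.Icc 0 A}ᶜ = 0
  simp only [staircaseLaw, Measure.add_apply, Measure.smul_apply, Measure.finsetSum_apply,
    Measure.dirac_apply' _ hm]
  have h1 : ∀ j : Fin n, (if k ≤ j then A else 0) ∈ Set.Icc 0 A := by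
    intro j; split_ifs <;> simp [hA]
  simp only [Set.indicator, Set.mem_compl_iff, Set.mem_ofPred_eq, h1]
  simp [hA]

lemma integral_staircaseLaw (hq : ∀ k, 0 ≤ q k) (hq1 : ∑ k, q k ≤ 1)
    {f : (Fin n → ℝ) → ℝ} :
    ∫ x, f x ∂staircaseLaw A q =
      (1 - ∑ k, q k) * f 0 + ∑ k, q k * f (fun i => if i ≤ k then A else 0) := by
  have hd : ∀ (c : ℝ) (a : Fin n → ℝ), Integrable f (ENNReal.ofReal c • Measure.dirac a) :=
    fun c a => (integrable_dirac (by simp)).smul_measure ENNReal.ofReal_ne_top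
  rw [staircaseLaw, integral_add_measure (hd _ _)
    (integrable_finsetSum_measure.2 fun k _ => hd _ _),
    integral_finsetSum_measure fun k _ => hd _ _]
  simp only [integral_smul_measure, integral_dirac, smul_eq_mul,
    ENNReal.toReal_ofReal (sub_nonneg.2 hq1), ENNReal.toReal_ofReal (hq _)]

lemma sum_mul_ite_le (h : Fin n → ℝ) (k : Fin n) :
    ∑ i, h i * (if i ≤ k then A else 0) = A * sCum h (k.val + 1) := by
  rw [sCum, Finset.mul_sum]
  refine Finset.sum_congr rfl fun i _ => ?_
  simp only [Fin.le_def, Nat.lt_succ_iff]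
  split_ifs <;> ring

lemma sum_ite_le (k : Fin n) :
    ∑ i, (if i ≤ k then A else 0) = A * ((k.val : ℝ) + 1) := by
  have : Finset.univ.filter (· ≤ k) = Finset.Iic k := by ext; simp
  rw [← Finset.sum_filter, Finset.sum_const, this, Fin.card_Iic]
  simp [mul_comm]

lemma sum_integral_staircaseLaw (hq : ∀ k, 0 ≤ q k) (hq1 : ∑ k, q k ≤ 1) :
    ∑ i, ∫ x, x i ∂staircaseLaw A q = (∑ k : Fin n, ((k.val : ℝ) + 1) * q k) * A := by
  simp only [integral_staircaseLaw hq hq1, Pi.zero_apply, mul_zero, zero_add]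
  rw [Finset.sum_comm, Finset.sum_mul]
  refine Finset.sum_congr rfl fun k _ => ?_
  rw [← Finset.mul_sum, sum_ite_le]
  ring

lemma variance_staircaseLaw (h : Fin n → ℝ) (hq : ∀ k, 0 ≤ q k) (hq1 : ∑ k, q k ≤ 1) :
    ∫ x, (∑ k, h k * x k - ∫ y, ∑ k, h k * y k ∂staircaseLaw A q) ^ 2 ∂staircaseLaw A q =
      A ^ 2 * signalVariance h q := by
  have hm : ∫ y, ∑ k, h k * y k ∂staircaseLaw A q =
      A * ∑ k : Fin n, sCum h (k.val + 1) * q k := by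
    rw [integral_staircaseLaw hq hq1]
    simp only [sum_mul_ite_le, Pi.zero_apply, mul_zero, Finset.sum_const_zero, zero_add,
      Finset.mul_sum]
    exact Finset.sum_congr rfl fun k _ => by ring
  rw [hm, integral_staircaseLaw hq hq1, signalVariance]
  simp only [sum_mul_ite_le, Pi.zero_apply, mul_zero, Finset.sum_const_zero]
  set M := ∑ k : Fin n, sCum h (k.val + 1) * q k with hM
  have : ∀ k : Fin n, q k * (A * sCum h (k.val + 1) - A * M) ^ 2 =
      A ^ 2 * (sCum h (k.val + 1) ^ 2 * q k) - 2 * A ^ 2 * M * (sCum h (k.val + 1) * q k) +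
        A ^ 2 * M ^ 2 * q k := fun k => by ring
  simp only [this, Finset.sum_add_distrib, Finset.sum_sub_distrib, ← Finset.mul_sum, ← hM]
  ring

end staircase

section capacity

variable {n : ℕ} {h : Fin n → ℝ} {v : ℝ≥0} {α : ℝ}

lemma misoJoint_eq_awgnJoint (μ : Measure (Fin n → ℝ)) :
    misoJoint h v μ = awgnJoint (fun x => ∑ k, h k * x k) v μ := rfl

/-- Signal variances reachable by randomized switching under the power budget `α`. -/
def signalVarianceSet (h : Fin n → ℝ) (α : ℝ) : Set ℝ :=
  {x : ℝ | ∃ q : Fin n → ℝ, (∀ k, 0 ≤ q k) ∧ (∑ k, q k) ≤ 1 ∧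
    (∑ k : Fin n, ((k.val : ℝ) + 1) * q k) ≤ α ∧ x = signalVariance h q}

lemma bddAbove_signalVarianceSet : BddAbove (signalVarianceSet h α) := by
  refine ⟨∑ k : Fin n, sCum h (k.val + 1) ^ 2, ?_⟩
  rintro _ ⟨q, hq, hq1, -, rfl⟩
  have : ∑ k : Fin n, sCum h (k.val + 1) ^ 2 * q k ≤ ∑ k : Fin n, sCum h (k.val + 1) ^ 2 :=
    Finset.sum_le_sum fun k _ => mul_le_of_le_one_right (sq_nonneg _)
      ((Finset.single_le_sum (fun i _ => hq i) (Finset.mem_univ k)).trans hq1)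
  rw [signalVariance]
  nlinarith [sq_nonneg (∑ k : Fin n, sCum h (k.val + 1) * q k)]

lemma nonempty_signalVarianceSet (hα : 0 ≤ α) : (signalVarianceSet h α).Nonempty :=
  ⟨_, 0, by simp, by simp, by simpa using hα, rfl⟩

lemma misoCapacity_le (hord : ∀ i j : Fin n, i ≤ j → h j ≤ h i) (hpos : ∀ k, 0 < h k)
    (hv : v ≠ 0) {A : ℝ} (hA : 0 < A) :
    misoCapacity h v A (α * A) ≤
      ((A ^ 2 * sSup (signalVarianceSet h α) / (2 * v) : ℝ) : EReal) := by
  refine iSup₂_le ?_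
  rintro μ ⟨hprob, hμ, hα⟩
  obtain ⟨q, hq, hq1, hqα, hvar⟩ := exists_weights_variance_le hord hpos hA hμ hα
  rw [misoJoint_eq_awgnJoint]
  refine (mutualInfo_awgnJoint_le (by fun_prop) hv (ae_abs_signal_sub_le hpos hμ)).trans ?_
  rw [EReal.coe_le_coe_iff]
  have hle := le_csSup bddAbove_signalVarianceSet
    (show signalVariance h q ∈ signalVarianceSet h α from ⟨q, hq, hq1, hqα, rfl⟩)
  gcongr
  exact hvar.trans (by gcongr)

lemma le_misoCapacity (hpos : ∀ k, 0 < h k) (hv : v ≠ 0) {A : ℝ} (hA : 0 ≤ A) {x : ℝ}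
    (hx : x ∈ signalVarianceSet h α) (hsmall : 3 * (A * sCum h n) ^ 2 / (2 * v) ≤ 1) :
    ((A ^ 2 * x / (2 * v) - (3 * (A * sCum h n) ^ 2 / (2 * v)) ^ 2 : ℝ) : EReal) ≤
      misoCapacity h v A (α * A) := by
  obtain ⟨q, hq, hq1, hqα, rfl⟩ := hx
  have := isProbabilityMeasure_staircaseLaw (A := A) hq hq1
  have hμ : ∀ k, ∀ᵐ x ∂staircaseLaw A q, x k ∈ Set.Icc 0 A := staircaseLaw_mem_Icc hA
  refine le_trans ?_ (le_iSup₂ (staircaseLaw A q) ⟨this, hμ, ?_⟩)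
  · rw [misoJoint_eq_awgnJoint, ← variance_staircaseLaw h hq hq1]
    exact le_mutualInfo_awgnJoint (by fun_prop) hv rfl (ae_abs_signal_sub_le hpos hμ) hsmall
  · rw [sum_integral_staircaseLaw hq hq1]
    gcongr

end capacity

theorem miso_capacity_low_snr_slope (n : ℕ) (hn : 2 ≤ n) (h : Fin n → ℝ)
    (hord : ∀ i j : Fin n, i ≤ j → h j ≤ h i) (hpos : ∀ k, 0 < h k)
    (v : ℝ≥0) (hv : 0 < v)
    (α : ℝ) (hα0 : 0 < α) (hαn : α < (n : ℝ) / 2)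
    (γ : ℝ)
    (hγ : γ = sSup {x : ℝ | ∃ q : Fin n → ℝ, (∀ k, 0 ≤ q k) ∧ (∑ k, q k) ≤ 1 ∧
      (∑ k : Fin n, ((k.val : ℝ) + 1) * q k) ≤ α ∧
      x = ∑ k : Fin n, (sCum h (k.val + 1)) ^ 2 * q k
        - (∑ k : Fin n, sCum h (k.val + 1) * q k) ^ 2}) :
    Tendsto (fun A : ℝ => misoCapacity h v A (α * A) / (((A ^ 2 / (v : ℝ)) : ℝ) : EReal))
      (nhdsWithin 0 (Set.Ioi 0))
      (nhds ((γ / 2 : ℝ) : EReal)) := by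
  have hv' : v ≠ 0 := hv.ne'
  have hvpos : (0 : ℝ) < v := hv
  replace hγ : γ = sSup (signalVarianceSet h α) := hγ
  refine tendsto_order.2 ⟨fun a ha => ?_, fun a ha => ?_⟩
  · obtain ⟨r, har, hrγ⟩ := EReal.lt_iff_exists_real_btwn.1 ha
    rw [EReal.coe_lt_coe_iff] at hrγ
    obtain ⟨x, hx, hrx⟩ := exists_lt_of_lt_csSup (nonempty_signalVarianceSet (h := h) hα0.le)
      (show 2 * r < sSup (signalVarianceSet h α) by rw [← hγ]; linarith)
    have hsmall : ∀ᶠ A in nhdsWithin (0 : ℝ) (Set.Ioi 0),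
        3 * (A * sCum h n) ^ 2 / (2 * v) < 1 := by
      refine (Continuous.tendsto' (by fun_prop) 0 0 (by simp)).mono_left nhdsWithin_le_nhds
        |>.eventually_lt_const one_pos
    have hrate : ∀ᶠ A in nhdsWithin (0 : ℝ) (Set.Ioi 0),
        r < x / 2 - 9 * A ^ 2 * sCum h n ^ 4 / (4 * v) := by
      refine (Continuous.tendsto' (by fun_prop) 0 (x / 2) (by simp)).mono_left nhdsWithin_le_nhds
        |>.eventually_const_lt (by linarith)
    filter_upwards [self_mem_nhdsWithin, hsmall, hrate] with A (hA : 0 < A) hA1 hA2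
    refine har.trans_le ?_
    have hpow : 0 < A ^ 2 / (v : ℝ) := by positivity
    rw [EReal.le_div_iff_mul_le (by exact_mod_cast hpow) (EReal.coe_ne_top _), ← EReal.coe_mul]
    refine le_trans ?_ (le_misoCapacity hpos hv' hA.le hx hA1.le)
    rw [EReal.coe_le_coe_iff]
    calc r * (A ^ 2 / v) ≤ (x / 2 - 9 * A ^ 2 * sCum h n ^ 4 / (4 * v)) * (A ^ 2 / v) := by
          gcongr
      _ = _ := by field_simp; ring
  · filter_upwards [self_mem_nhdsWithin] with A (hA : 0 < A)
    refine lt_of_le_of_lt ?_ ha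
    have hpow : 0 < A ^ 2 / (v : ℝ) := by positivity
    rw [EReal.div_le_iff_le_mul (by exact_mod_cast hpow) (EReal.coe_ne_top _), ← EReal.coe_mul]
    refine (misoCapacity_le hord hpos hv' hA).trans_eq ?_
    rw [← hγ]
    congr 1
    field_simp
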